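/- Assume in addition that A is positive definite and k ≥ 1. Then the Lanczos-FA approximation of the square root satisfies ‖A^{1/2} b − Q T^{1/2} Qᴴ b‖₂ ≤ ( λ_max(A)^{3/2} / (2√π) ) · ( Γ(k − 1/2) / Γ(k + 1) ) · ‖err_k(0)‖₂, where Γ denotes the Gamma function and A^{1/2}, T^{1/2} are the positive semidefinite square roots of A and T. -/

import Mathlib

open Matrix MeasureTheory

/-- The Euclidean 2-norm of a complex vector. -/
noncomputable def norm2 {n : ℕ} (v : Fin n → ℂ) : ℝ :=
  Real.sqrt (∑ i, ‖v i‖ ^ 2)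
open scoped ComplexOrder

/-- Apply a scalar function to a Hermitian matrix through its spectral decomposition. -/
noncomputable def matFun {m : ℕ} {B : Matrix (Fin m) (Fin m) ℂ}
    (hB : B.IsHermitian) (f : ℝ → ℂ) : Matrix (Fin m) (Fin m) ℂ :=
  (hB.eigenvectorUnitary : Matrix (Fin m) (Fin m) ℂ) *
    Matrix.diagonal (fun i => f (hB.eigenvalues i)) *
    star (hB.eigenvectorUnitary : Matrix (Fin m) (Fin m) ℂ)

/-- The Lanczos-FA error for the shifted linear system `(A - z I) x = b`. -/
noncomputable def errK {n k : ℕ} (A : Matrix (Fin n) (Fin n) ℂ) (Q : Matrix (Fin n) (Fin k) ℂ)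
    (T : Matrix (Fin k) (Fin k) ℂ) (b : Fin n → ℂ) (z : ℂ) : Fin n → ℂ :=
  (A - z • 1)⁻¹.mulVec b - (Q * (T - z • 1)⁻¹ * Qᴴ).mulVec b

/-- The Lanczos-FA residual for the shifted linear system `(A - z I) x = b`. -/
noncomputable def resK {n k : ℕ} (A : Matrix (Fin n) (Fin n) ℂ) (Q : Matrix (Fin n) (Fin k) ℂ)
    (T : Matrix (Fin k) (Fin k) ℂ) (b : Fin n → ℂ) (z : ℂ) : Fin n → ℂ :=
  b - ((A - z • 1) * (Q * (T - z • 1)⁻¹ * Qᴴ)).mulVec b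

theorem norm2_eq_norm_toLp {n : ℕ} (v : Fin n → ℂ) : norm2 v = ‖WithLp.toLp 2 v‖ := by
  simp [norm2, EuclideanSpace.norm_eq]

theorem norm2_sq {n : ℕ} (v : Fin n → ℂ) : ((norm2 v ^ 2 : ℝ) : ℂ) = star v ⬝ᵥ v := by
  rw [norm2, Real.sq_sqrt (by positivity)]
  push_cast
  simp [dotProduct, ← Complex.conj_mul']

theorem norm2_isometry_mulVec {m n : ℕ} (U : Matrix (Fin m) (Fin n) ℂ) (hU : Uᴴ * U = 1)
    (v : Fin n → ℂ) :
    norm2 (U *ᵥ v) = norm2 v := by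
  have h : norm2 (U *ᵥ v) ^ 2 = norm2 v ^ 2 := by
    rw [← Complex.ofReal_inj, norm2_sq, norm2_sq, star_mulVec, ← dotProduct_mulVec, mulVec_mulVec,
      hU, one_mulVec]
  exact (sq_eq_sq₀ (Real.sqrt_nonneg _) (Real.sqrt_nonneg _)).1 h

section MatFun

variable {m : ℕ} {B : Matrix (Fin m) (Fin m) ℂ} (hB : B.IsHermitian)

theorem matFun_mul (f g : ℝ → ℂ) : matFun hB f * matFun hB g = matFun hB (fun x => f x * g x) := by
  simp only [matFun]
  set U := (hB.eigenvectorUnitary : Matrix (Fin m) (Fin m) ℂ) with hU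
  have h : star U * U = 1 := Unitary.coe_star_mul_self _
  rw [← diagonal_mul_diagonal]
  calc _ = U * diagonal (fun i => f (hB.eigenvalues i)) * (star U * U) *
        diagonal (fun i => g (hB.eigenvalues i)) * star U := by simp only [Matrix.mul_assoc]
    _ = _ := by rw [h]; simp only [Matrix.mul_assoc, Matrix.one_mul]

theorem matFun_sub (f g : ℝ → ℂ) : matFun hB (fun x => f x - g x) = matFun hB f - matFun hB g := by
  simp only [matFun]
  rw [← diagonal_sub, Matrix.mul_sub, Matrix.sub_mul]

theorem matFun_const (c : ℂ) : matFun hB (fun _ => c) = c • 1 := by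
  have h : (hB.eigenvectorUnitary : Matrix (Fin m) (Fin m) ℂ) * star _ = 1 :=
    Unitary.coe_mul_star_self hB.eigenvectorUnitary
  have h2 : (diagonal fun _ : Fin m => c) = c • 1 := by
    ext i j; simp [Matrix.one_apply, diagonal_apply]
  simp only [matFun]
  rw [h2, Matrix.mul_smul, Matrix.mul_one, Matrix.smul_mul, h]

theorem matFun_id : matFun hB (fun x => (x : ℂ)) = B := by
  conv_rhs => rw [hB.spectral_theorem]
  simp [matFun, Unitary.conjStarAlgAut_apply, Function.comp_def]

theorem matFun_sub_const (c : ℂ) : matFun hB (fun x => (x : ℂ) - c) = B - c • 1 := by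
  rw [matFun_sub hB (fun x => (x : ℂ)) (fun _ => c), matFun_id, matFun_const]

theorem matFun_const_sub (c : ℂ) : matFun hB (fun x => c - (x : ℂ)) = c • 1 - B := by
  rw [matFun_sub hB (fun _ => c) (fun x => (x : ℂ)), matFun_id, matFun_const]

theorem inv_shift_eq_matFun (c : ℂ) (hc : ∀ i, (hB.eigenvalues i : ℂ) - c ≠ 0) :
    (B - c • 1)⁻¹ = matFun hB (fun x => ((x : ℂ) - c)⁻¹) := by
  apply Matrix.inv_eq_right_inv
  rw [← matFun_sub_const hB, matFun_mul, ← one_smul ℂ (1 : Matrix (Fin m) (Fin m) ℂ),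
    ← matFun_const hB]
  simp only [matFun]
  congr! 3
  ext i
  exact mul_inv_cancel₀ (hc i)

theorem det_matFun (f : ℝ → ℂ) : (matFun hB f).det = ∏ i, f (hB.eigenvalues i) := by
  have h : (hB.eigenvectorUnitary : Matrix (Fin m) (Fin m) ℂ) * star _ = 1 :=
    Unitary.coe_mul_star_self hB.eigenvectorUnitary
  have h := congrArg Matrix.det h
  rw [det_mul, det_one] at h
  rw [matFun, det_mul, det_mul, det_diagonal, mul_right_comm, h, one_mul]

theorem exists_matFun_eq_sum : ∃ P : Fin m → Matrix (Fin m) (Fin m) ℂ,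
    ∀ f : ℝ → ℂ, matFun hB f = ∑ i, f (hB.eigenvalues i) • P i := by
  refine ⟨fun i => (hB.eigenvectorUnitary : Matrix (Fin m) (Fin m) ℂ) * single i i 1 *
    star (hB.eigenvectorUnitary : Matrix (Fin m) (Fin m) ℂ), fun f => ?_⟩
  have h : diagonal (fun i => f (hB.eigenvalues i)) =
      ∑ i, f (hB.eigenvalues i) • single i i (1 : ℂ) := by
    simp [smul_single, sum_single_eq_diagonal]
  simp only [matFun]
  rw [h, Matrix.mul_sum, Matrix.sum_mul]
  simp only [Matrix.mul_smul, Matrix.smul_mul]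

theorem norm2_matFun_mulVec_le (f : ℝ → ℂ) (c : ℝ) (hc0 : 0 ≤ c)
    (hc : ∀ i, ‖f (hB.eigenvalues i)‖ ≤ c) (v : Fin m → ℂ) :
    norm2 (matFun hB f *ᵥ v) ≤ c * norm2 v := by
  have hl : star (hB.eigenvectorUnitary : Matrix (Fin m) (Fin m) ℂ) *
    (hB.eigenvectorUnitary : Matrix (Fin m) (Fin m) ℂ) = 1 := Unitary.coe_star_mul_self _
  have hr : (hB.eigenvectorUnitary : Matrix (Fin m) (Fin m) ℂ) *
    star (hB.eigenvectorUnitary : Matrix (Fin m) (Fin m) ℂ) = 1 := Unitary.coe_mul_star_self _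
  rw [matFun, ← mulVec_mulVec, ← mulVec_mulVec, norm2_isometry_mulVec _ hl,
    ← norm2_isometry_mulVec (star (hB.eigenvectorUnitary : Matrix (Fin m) (Fin m) ℂ))
      (by rw [star_eq_conjTranspose, conjTranspose_conjTranspose]; exact hr) v]
  set w := star (hB.eigenvectorUnitary : Matrix (Fin m) (Fin m) ℂ) *ᵥ v
  rw [norm2, norm2]
  refine Real.sqrt_le_iff.2 ⟨by positivity, ?_⟩
  rw [mul_pow, Real.sq_sqrt (by positivity), Finset.mul_sum]
  refine Finset.sum_le_sum fun i _ => ?_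
  rw [mulVec_diagonal, norm_mul, mul_pow]
  gcongr
  exact hc i

end MatFun

theorem adjugate_corner_tridiagonal {m : ℕ} (T : Matrix (Fin (m + 1)) (Fin (m + 1)) ℂ)
    (hT : ∀ i j : Fin (m + 1), (j : ℕ) + 1 < (i : ℕ) → T i j = 0) (z : ℂ) :
    (T - z • 1).adjugate (Fin.last m) 0 = T.adjugate (Fin.last m) 0 := by
  have key : ∀ c : ℂ, (T - c • 1).adjugate (Fin.last m) 0 =
      (-1) ^ m * ∏ i : Fin m, T i.succ i.castSucc := by
    intro c
    rw [adjugate_fin_succ_eq_det_submatrix, det_of_isUpperTriangular]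
    · simp [Fin.ext_iff]
    · intro i j hij
      have hij : (j : ℕ) < i := hij
      have h1 : T i.succ j.castSucc = 0 := hT _ _ (by simpa using hij)
      simp [h1, Matrix.one_apply, Fin.ext_iff]
      omega
  rw [key, ← key 0]
  simp

open Filter Topology in
theorem integral_sqrt_mul_inv_sub_inv {x : ℝ} (hx : 0 < x) :
    IntegrableOn (fun t : ℝ => √t * (t⁻¹ - (x + t)⁻¹)) (Set.Ioi 0) ∧
      ∫ t in Set.Ioi (0 : ℝ), √t * (t⁻¹ - (x + t)⁻¹) = Real.pi * √x := by
  have hsx : 0 < √x := Real.sqrt_pos.2 hx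
  have hcont : ContinuousWithinAt (fun t : ℝ => 2 * √x * Real.arctan (√t / √x)) (Set.Ici 0) 0 := by
    fun_prop (disch := positivity)
  have hderiv : ∀ t ∈ Set.Ioi (0 : ℝ), HasDerivAt (fun t : ℝ => 2 * √x * Real.arctan (√t / √x))
      (√t * (t⁻¹ - (x + t)⁻¹)) t := by
    intro t ht
    have ht : 0 < t := ht
    have hst : 0 < √t := Real.sqrt_pos.2 ht
    refine ((((Real.hasDerivAt_sqrt ht.ne').div_const (√x)).arctan).const_mul
      (2 * √x)).congr_deriv ?_
    have h1 : √x ^ 2 = x := Real.sq_sqrt hx.le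
    have h2 : √t ^ 2 = t := Real.sq_sqrt ht.le
    generalize √x = u at *
    generalize √t = v at *
    subst h1 h2
    field_simp
    ring
  have hpos : ∀ t ∈ Set.Ioi (0 : ℝ), 0 ≤ √t * (t⁻¹ - (x + t)⁻¹) := by
    intro t ht
    have ht : 0 < t := ht
    have : (x + t)⁻¹ ≤ t⁻¹ := inv_anti₀ ht (by linarith)
    exact mul_nonneg (Real.sqrt_nonneg _) (by linarith)
  have hlim : Tendsto (fun t : ℝ => 2 * √x * Real.arctan (√t / √x)) atTop
      (𝓝 (2 * √x * (Real.pi / 2))) :=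
    (((Real.tendsto_arctan_atTop.mono_right nhdsWithin_le_nhds).comp
      (Real.tendsto_sqrt_atTop.atTop_div_const hsx))).const_mul _
  refine ⟨integrableOn_Ioi_deriv_of_nonneg hcont hderiv hpos hlim, ?_⟩
  rw [integral_Ioi_of_hasDerivAt_of_nonneg hcont hderiv hpos hlim]
  simp
  ring

open Filter Topology in
theorem tendsto_sqrt_div_add_atTop (L : ℝ) : Tendsto (fun t : ℝ => √t / (L + t)) atTop (𝓝 0) := by
  have h1 : Tendsto (fun t : ℝ => (√t)⁻¹ / (L / t + 1)) atTop (𝓝 (0 / (0 + 1))) :=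
    Tendsto.div (tendsto_inv_atTop_zero.comp Real.tendsto_sqrt_atTop)
      ((tendsto_const_nhds.div_atTop tendsto_id).add_const _) (by norm_num)
  simp only [zero_div] at h1
  refine h1.congr' ?_
  filter_upwards [eventually_gt_atTop 0, eventually_gt_atTop (-L)] with t ht htL
  have : 0 < √t := Real.sqrt_pos.2 ht
  have h3 : L + t ≠ 0 := by linarith
  have h2 : √t ^ 2 = t := Real.sq_sqrt ht.le
  generalize √t = v at *
  subst h2
  have h4 : L / v ^ 2 + 1 = (L + v ^ 2) / v ^ 2 := by field_simp
  rw [h4]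
  field_simp

open Filter Topology in
theorem integral_sqrt_mul_div_pow {L : ℝ} (hL : 0 < L) (k : ℕ) :
    IntegrableOn (fun t : ℝ => √t * (L / (L + t)) ^ (k + 2)) (Set.Ioi 0) ∧
      ∫ t in Set.Ioi (0 : ℝ), √t * (L / (L + t)) ^ (k + 2) =
        L ^ ((3 : ℝ) / 2) * (√Real.pi / 2) *
          (Real.Gamma ((k + 1 : ℝ) - 1 / 2) / Real.Gamma ((k + 1 : ℝ) + 1)) := by
  have hsL : 0 < √L := Real.sqrt_pos.2 hL
  have hpow : L ^ ((3 : ℝ) / 2) = √L ^ 3 := by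
    rw [Real.sqrt_eq_rpow, ← Real.rpow_natCast, ← Real.rpow_mul hL.le]; norm_num
  induction k with
  | zero =>
    have hcont : ContinuousWithinAt
        (fun t : ℝ => √L ^ 3 * Real.arctan (√t / √L) - L ^ 2 * (√t / (L + t))) (Set.Ici 0) 0 := by
      fun_prop (disch := positivity)
    have hderiv : ∀ t ∈ Set.Ioi (0 : ℝ), HasDerivAt
        (fun t : ℝ => √L ^ 3 * Real.arctan (√t / √L) - L ^ 2 * (√t / (L + t)))
        (√t * (L / (L + t)) ^ (0 + 2)) t := by
      intro t ht
      have ht : 0 < t := ht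
      have hst : 0 < √t := Real.sqrt_pos.2 ht
      have hd := Real.hasDerivAt_sqrt ht.ne'
      refine (((hd.div_const (√L)).arctan.const_mul (√L ^ 3)).sub
        ((hd.div ((hasDerivAt_id' t).const_add L) (by simp; positivity)).const_mul (L ^ 2))).congr_deriv ?_
      have h1 : √L ^ 2 = L := Real.sq_sqrt hL.le
      have h2 : √t ^ 2 = t := Real.sq_sqrt ht.le
      generalize √L = u at *
      generalize √t = v at *
      subst h1 h2
      rw [zero_add]
      field_simp
      ring
    have hpos : ∀ t ∈ Set.Ioi (0 : ℝ), 0 ≤ √t * (L / (L + t)) ^ (0 + 2) := by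
      intro t ht
      have ht : 0 < t := ht
      positivity
    have hlim : Tendsto (fun t : ℝ => √L ^ 3 * Real.arctan (√t / √L) - L ^ 2 * (√t / (L + t))) atTop
        (𝓝 (√L ^ 3 * (Real.pi / 2) - L ^ 2 * 0)) :=
      (((Real.tendsto_arctan_atTop.mono_right nhdsWithin_le_nhds).comp
        (Real.tendsto_sqrt_atTop.atTop_div_const hsL)).const_mul _).sub
        ((tendsto_sqrt_div_add_atTop L).const_mul _)
    refine ⟨integrableOn_Ioi_deriv_of_nonneg hcont hderiv hpos hlim, ?_⟩
    rw [integral_Ioi_of_hasDerivAt_of_nonneg hcont hderiv hpos hlim, hpow]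
    have h1 : ((0 : ℕ) + 1 : ℝ) - 1 / 2 = 1 / 2 := by norm_num
    have h2 : ((0 : ℕ) + 1 : ℝ) + 1 = 2 := by norm_num
    have hp : √Real.pi * √Real.pi = Real.pi := Real.mul_self_sqrt Real.pi_pos.le
    rw [h1, h2, Real.Gamma_one_half_eq, Real.Gamma_two]
    simp
    linear_combination (-√L ^ 3 / 2) * hp
  | succ k ih =>
    obtain ⟨hint, hval⟩ := ih
    have hint' : IntegrableOn (fun t : ℝ => √t * (L / (L + t)) ^ (k + 1 + 2)) (Set.Ioi 0) := by
      refine Integrable.mono' hint ?_ ?_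
      · exact (by fun_prop : Measurable _).aestronglyMeasurable
      · refine (ae_restrict_iff' measurableSet_Ioi).2 (Eventually.of_forall fun t ht => ?_)
        have ht : 0 < t := ht
        rw [Real.norm_of_nonneg (by positivity)]
        gcongr ?_ * ?_
        exact pow_le_pow_of_le_one (by positivity) ((div_le_one (by positivity)).2 (by linarith))
          (by lia)
    refine ⟨hint', ?_⟩
    have hcont : ContinuousWithinAt
        (fun t : ℝ => t * √t * (L / (L + t)) ^ (k + 2)) (Set.Ici 0) 0 := by
      fun_prop (disch := positivity)
    have hderiv : ∀ t ∈ Set.Ioi (0 : ℝ), HasDerivAt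
        (fun t : ℝ => t * √t * (L / (L + t)) ^ (k + 2))
        ((k + 2) * (√t * (L / (L + t)) ^ (k + 1 + 2)) -
          (k + 1 / 2) * (√t * (L / (L + t)) ^ (k + 2))) t := by
      intro t ht
      have ht : 0 < t := ht
      have hst : 0 < √t := Real.sqrt_pos.2 ht
      have hd := Real.hasDerivAt_sqrt ht.ne'
      refine (((hasDerivAt_id' t).mul hd).mul ((((hasDerivAt_const t L).div
        ((hasDerivAt_id' t).const_add L) (by simp; positivity))).pow (k + 2))).congr_deriv ?_
      simp only [Pi.mul_apply]
      have h2 : √t ^ 2 = t := Real.sq_sqrt ht.le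
      generalize √t = v at *
      subst h2
      have : L + v ^ 2 ≠ 0 := by positivity
      simp [div_pow, pow_succ]
      field_simp
      ring
    have hlim : Tendsto (fun t : ℝ => t * √t * (L / (L + t)) ^ (k + 2)) atTop (𝓝 0) := by
      have hz := (tendsto_sqrt_div_add_atTop L).const_mul (L ^ 2)
      rw [mul_zero] at hz
      refine squeeze_zero' ?_ ?_ hz
      · filter_upwards [eventually_gt_atTop 0] with t ht
        positivity
      · filter_upwards [eventually_gt_atTop 0] with t ht
        have h1 : L / (L + t) ≤ 1 := (div_le_one (by positivity)).2 (by linarith)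
        calc t * √t * (L / (L + t)) ^ (k + 2) ≤ (L + t) * √t * (L / (L + t)) ^ 2 := by
              gcongr ?_ * _ * ?_
              · linarith
              · exact pow_le_pow_of_le_one (by positivity) h1 (by lia)
          _ = _ := by field_simp
    have hI := integral_Ioi_of_hasDerivAt_of_tendsto hcont hderiv
      ((hint'.const_mul _).sub (hint.const_mul _)) hlim
    rw [integral_sub (hint'.const_mul _) (hint.const_mul _), integral_const_mul,
      integral_const_mul, hval] at hI
    have hk2 : (k : ℝ) + 2 ≠ 0 := by positivity
    have hk1 : (k : ℝ) + 1 / 2 ≠ 0 := by positivity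
    have g1 : ((k + 1 : ℕ) + 1 : ℝ) - 1 / 2 = (k + 1 / 2) + 1 := by push_cast; ring
    have g2 : ((k + 1 : ℕ) + 1 : ℝ) + 1 = (k + 2) + 1 := by push_cast; ring
    have g3 : (k + 1 : ℝ) - 1 / 2 = k + 1 / 2 := by ring
    have g4 : (k + 1 : ℝ) + 1 = k + 2 := by ring
    rw [g1, g2, Real.Gamma_add_one hk1, Real.Gamma_add_one hk2]
    rw [g3, g4] at hI
    have hG : Real.Gamma (k + 2 : ℝ) ≠ 0 := (Real.Gamma_pos_of_pos (by positivity)).ne'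
    simp only [zero_mul, sub_zero] at hI
    apply mul_left_cancel₀ hk2
    rw [sub_eq_zero.1 hI]
    field_simp

section Lanczos

variable {n m : ℕ} {A : Matrix (Fin n) (Fin n) ℂ} {Q : Matrix (Fin n) (Fin (m + 1)) ℂ}
  {T : Matrix (Fin (m + 1)) (Fin (m + 1)) ℂ} {b q : Fin n → ℂ} {c : ℂ}

theorem shift_mulVec_errK (hQQ : Q *ᵥ (Qᴴ *ᵥ b) = b) (hQb : Qᴴ *ᵥ b = c • Pi.single 0 1)
    (hT : ∀ i j : Fin (m + 1), (j : ℕ) + 1 < (i : ℕ) → T i j = 0)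
    (hAQ : A * Q = Q * T + vecMulVec q (Pi.single (Fin.last m) 1)) (z : ℂ)
    (hA : IsUnit (A - z • 1).det) (hTz : IsUnit (T - z • 1).det) :
    (A - z • 1) *ᵥ errK A Q T b z =
      (-(c * T.adjugate (Fin.last m) 0) / (T - z • 1).det) • q := by
  have hshift : (A - z • 1) * Q = Q * (T - z • 1) + vecMulVec q (Pi.single (Fin.last m) 1) := by
    rw [Matrix.sub_mul, hAQ, Matrix.mul_sub, Matrix.smul_mul, Matrix.mul_smul, Matrix.one_mul,
      Matrix.mul_one]
    abel
  have hentry : (T - z • 1)⁻¹ (Fin.last m) 0 = T.adjugate (Fin.last m) 0 / (T - z • 1).det := by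
    rw [Matrix.inv_def, Matrix.smul_apply, adjugate_corner_tridiagonal T hT, Ring.inverse_eq_inv',
      smul_eq_mul, div_eq_inv_mul]
  rw [errK, mulVec_sub, mulVec_mulVec, Matrix.mul_nonsing_inv _ hA, one_mulVec, mulVec_mulVec,
    ← Matrix.mul_assoc, ← Matrix.mul_assoc, hshift, Matrix.add_mul, Matrix.mul_assoc Q,
    Matrix.mul_nonsing_inv _ hTz, Matrix.mul_one, Matrix.add_mul, add_mulVec, ← mulVec_mulVec, hQQ,
    vecMulVec_mul, ← mulVec_mulVec, hQb, vecMulVec_mulVec]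
  ext i
  simp [hentry]
  ring

theorem errK_eq_smul_mulVec (hQQ : Q *ᵥ (Qᴴ *ᵥ b) = b) (hQb : Qᴴ *ᵥ b = c • Pi.single 0 1)
    (hT : ∀ i j : Fin (m + 1), (j : ℕ) + 1 < (i : ℕ) → T i j = 0)
    (hAQ : A * Q = Q * T + vecMulVec q (Pi.single (Fin.last m) 1)) (z : ℂ)
    (hA : IsUnit A.det) (hAz : IsUnit (A - z • 1).det)
    (hT0 : IsUnit T.det) (hTz : IsUnit (T - z • 1).det) :
    errK A Q T b z = (T.det / (T - z • 1).det) • ((A - z • 1)⁻¹ * A) *ᵥ errK A Q T b 0 := by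
  have h0 := shift_mulVec_errK hQQ hQb hT hAQ 0 (by simpa using hA) (by simpa using hT0)
  have hz := shift_mulVec_errK hQQ hQb hT hAQ z hAz hTz
  simp only [zero_smul, sub_zero] at h0
  have hT0' := hT0.ne_zero
  rw [← mulVec_mulVec, h0, ← mulVec_smul, smul_smul]
  have : T.det / (T - z • 1).det * (-(c * T.adjugate (Fin.last m) 0) / T.det) =
      -(c * T.adjugate (Fin.last m) 0) / (T - z • 1).det := by field_simp
  rw [this, ← hz, mulVec_mulVec, Matrix.nonsing_inv_mul _ hAz, one_mulVec]

end Lanczos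

/-- Cauchy interlacing at the top end of the spectrum, for the compression `T = Qᴴ A Q`. -/
theorem eigenvalues_compression_le {n k : ℕ} {A : Matrix (Fin n) (Fin n) ℂ} (hA : A.IsHermitian)
    {Q : Matrix (Fin n) (Fin k) ℂ} (hQ : Qᴴ * Q = 1) {T : Matrix (Fin k) (Fin k) ℂ}
    (hT : T.IsHermitian) (hTA : Qᴴ * A * Q = T) {L : ℝ} (hL : ∀ i, hA.eigenvalues i ≤ L)
    (j : Fin k) : hT.eigenvalues j ≤ L := by
  have hpsd : ((L : ℂ) • 1 - A).PosSemidef := by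
    rw [← matFun_const_sub hA, matFun, star_eq_conjTranspose]
    refine PosSemidef.mul_mul_conjTranspose_same (PosSemidef.diagonal fun i => ?_) _
    simpa [← Complex.ofReal_sub] using hL i
  have hU : (hT.eigenvectorUnitary : Matrix (Fin k) (Fin k) ℂ)ᴴ *
      (hT.eigenvectorUnitary : Matrix (Fin k) (Fin k) ℂ) = 1 := Unitary.coe_star_mul_self _
  have hcomp : Qᴴ * ((L : ℂ) • 1 - A) * Q = matFun hT (fun x => (L : ℂ) - x) := by
    rw [matFun_const_sub, ← hTA, Matrix.mul_sub, Matrix.sub_mul, Matrix.mul_smul, Matrix.smul_mul,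
      Matrix.mul_one, hQ]
  have hdiag := (hpsd.conjTranspose_mul_mul_same Q).conjTranspose_mul_mul_same
    (hT.eigenvectorUnitary : Matrix (Fin k) (Fin k) ℂ)
  rw [hcomp, matFun, star_eq_conjTranspose, Matrix.mul_assoc, Matrix.mul_assoc _ _ (_ᴴ),
    Matrix.mul_assoc, Matrix.mul_assoc, hU, Matrix.mul_one, ← Matrix.mul_assoc, hU, Matrix.one_mul,
    posSemidef_diagonal_iff] at hdiag
  have hj := hdiag j
  rwa [← Complex.ofReal_sub, Complex.zero_le_real, sub_nonneg] at hj

theorem norm2_errK_le {n m : ℕ} {A : Matrix (Fin n) (Fin n) ℂ} (hA : A.IsHermitian)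
    {Q : Matrix (Fin n) (Fin (m + 1)) ℂ} {T : Matrix (Fin (m + 1)) (Fin (m + 1)) ℂ}
    (hTH : T.IsHermitian) {b q : Fin n → ℂ} {c : ℂ}
    (hQQ : Q *ᵥ (Qᴴ *ᵥ b) = b) (hQb : Qᴴ *ᵥ b = c • Pi.single 0 1)
    (hT : ∀ i j : Fin (m + 1), (j : ℕ) + 1 < (i : ℕ) → T i j = 0)
    (hAQ : A * Q = Q * T + vecMulVec q (Pi.single (Fin.last m) 1)) {L t : ℝ}
    (hA0 : ∀ i, 0 < hA.eigenvalues i) (hAL : ∀ i, hA.eigenvalues i ≤ L)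
    (hT0 : ∀ i, 0 < hTH.eigenvalues i) (hTL : ∀ i, hTH.eigenvalues i ≤ L) (hL : 0 < L)
    (ht : 0 < t) :
    norm2 (errK A Q T b (-t : ℝ)) ≤ (L / (L + t)) ^ (m + 2) * norm2 (errK A Q T b 0) := by
  have hfrac : ∀ x : ℝ, 0 < x → x ≤ L → ‖(x : ℂ) / ((x : ℂ) - (-t : ℝ))‖ ≤ L / (L + t) := by
    intro x hx hxL
    have : (x : ℂ) / ((x : ℂ) - (-t : ℝ)) = ((x / (x + t) : ℝ) : ℂ) := by push_cast; ring
    rw [this, Complex.norm_of_nonneg (by positivity), div_le_div_iff₀ (by positivity)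
      (by positivity)]
    nlinarith
  have hne : ∀ x : ℝ, 0 < x → (x : ℂ) - (-t : ℝ) ≠ 0 := by
    intro x hx
    rw [← Complex.ofReal_sub, Complex.ofReal_ne_zero]
    linarith
  have hdetA : A.det = ∏ i, (hA.eigenvalues i : ℂ) := by
    conv_lhs => rw [← matFun_id hA, det_matFun]
  have hdetT : T.det = ∏ i, (hTH.eigenvalues i : ℂ) := by
    conv_lhs => rw [← matFun_id hTH, det_matFun]
  have hdetAz : (A - ((-t : ℝ) : ℂ) • 1).det = ∏ i, ((hA.eigenvalues i : ℂ) - (-t : ℝ)) := by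
    rw [← matFun_sub_const hA, det_matFun]
  have hdetTz : (T - ((-t : ℝ) : ℂ) • 1).det = ∏ i, ((hTH.eigenvalues i : ℂ) - (-t : ℝ)) := by
    rw [← matFun_sub_const hTH, det_matFun]
  rw [errK_eq_smul_mulVec hQQ hQb hT hAQ ((-t : ℝ) : ℂ)
    (by rw [isUnit_iff_ne_zero, hdetA, Finset.prod_ne_zero_iff]
        exact fun i _ => Complex.ofReal_ne_zero.2 (hA0 i).ne')
    (by rw [isUnit_iff_ne_zero, hdetAz, Finset.prod_ne_zero_iff]; exact fun i _ => hne _ (hA0 i))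
    (by rw [isUnit_iff_ne_zero, hdetT, Finset.prod_ne_zero_iff]
        exact fun i _ => Complex.ofReal_ne_zero.2 (hT0 i).ne')
    (by rw [isUnit_iff_ne_zero, hdetTz, Finset.prod_ne_zero_iff]; exact fun i _ => hne _ (hT0 i)),
    inv_shift_eq_matFun hA _ fun i => hne _ (hA0 i)]
  nth_rewrite 2 [← matFun_id hA]
  rw [matFun_mul, norm2_eq_norm_toLp, WithLp.toLp_smul, norm_smul,
    ← norm2_eq_norm_toLp, pow_succ, mul_assoc]
  gcongr
  · exact Real.sqrt_nonneg _
  · rw [hdetT, hdetTz, ← Finset.prod_div_distrib, norm_prod]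
    refine (Finset.prod_le_prod (fun _ _ => norm_nonneg _)
      fun i _ => hfrac _ (hT0 i) (hTL i)).trans_eq ?_
    simp [div_pow]
  · refine norm2_matFun_mulVec_le hA _ _ (by positivity) (fun i => ?_) _
    rw [← div_eq_inv_mul]
    exact hfrac _ (hA0 i) (hAL i)

/-- The integral representation of the error of the Lanczos-FA approximation to the square root. -/
theorem sqrt_error_eq_integral {n k : ℕ} {A : Matrix (Fin n) (Fin n) ℂ} (hA : A.IsHermitian)
    {Q : Matrix (Fin n) (Fin k) ℂ} {T : Matrix (Fin k) (Fin k) ℂ}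
    (hT : T.IsHermitian) {b : Fin n → ℂ} (hQQ : Q *ᵥ (Qᴴ *ᵥ b) = b)
    (hA0 : ∀ i, 0 < hA.eigenvalues i) (hT0 : ∀ i, 0 < hT.eigenvalues i) :
    WithLp.toLp 2 ((matFun hA fun x : ℝ => ((√x : ℝ) : ℂ)) *ᵥ b -
        (Q * matFun hT (fun x : ℝ => ((√x : ℝ) : ℂ)) * Qᴴ) *ᵥ b) =
      -(Real.pi⁻¹ • ∫ t in Set.Ioi (0 : ℝ), √t • WithLp.toLp 2 (errK A Q T b (-t : ℝ))) := by
  obtain ⟨P, hP⟩ := exists_matFun_eq_sum hA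
  obtain ⟨R, hR⟩ := exists_matFun_eq_sum hT
  set x : Fin n → EuclideanSpace ℂ (Fin n) := fun i => WithLp.toLp 2 (P i *ᵥ b) with hx
  set y : Fin k → EuclideanSpace ℂ (Fin n) := fun i => WithLp.toLp 2 ((Q * R i * Qᴴ) *ᵥ b) with hy
  have hsum : ∀ f g : ℝ → ℝ, WithLp.toLp 2 (matFun hA (fun x => (f x : ℂ)) *ᵥ b -
      (Q * matFun hT (fun x => (g x : ℂ)) * Qᴴ) *ᵥ b) =
      ∑ i, f (hA.eigenvalues i) • x i - ∑ j, g (hT.eigenvalues j) • y j := by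
    intro f g
    rw [hP, hR, Matrix.mul_sum, Matrix.sum_mul, sum_mulVec, sum_mulVec, WithLp.toLp_sub,
      WithLp.toLp_sum, WithLp.toLp_sum]
    simp only [Matrix.mul_smul, Matrix.smul_mul, smul_mulVec, WithLp.toLp_smul, hx, hy,
      Complex.coe_smul]
  have hone : ∑ i, x i - ∑ j, y j = 0 := by
    have h := hsum (fun _ => 1) (fun _ => 1)
    rw [matFun_const, matFun_const] at h
    simp only [Complex.ofReal_one, one_smul, one_mulVec, Matrix.mul_one] at h
    rw [← h, ← mulVec_mulVec, hQQ, sub_self, WithLp.toLp_zero]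
  have herr : ∀ t ∈ Set.Ioi (0 : ℝ), √t • WithLp.toLp 2 (errK A Q T b (-t : ℝ)) =
      -(∑ i, (√t * (t⁻¹ - (hA.eigenvalues i + t)⁻¹)) • x i -
        ∑ j, (√t * (t⁻¹ - (hT.eigenvalues j + t)⁻¹)) • y j) := by
    intro t ht
    have ht : 0 < t := ht
    have hne : ∀ x : ℝ, 0 < x → (x : ℂ) - (-t : ℝ) ≠ 0 := by
      intro x hx
      rw [← Complex.ofReal_sub, Complex.ofReal_ne_zero]
      linarith
    have hf : (fun x : ℝ => ((x : ℂ) - (-t : ℝ))⁻¹) = fun x : ℝ => (((x + t)⁻¹ : ℝ) : ℂ) := by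
      ext x; push_cast; ring
    rw [errK, inv_shift_eq_matFun hA _ fun i => hne _ (hA0 i),
      inv_shift_eq_matFun hT _ fun i => hne _ (hT0 i), hf, hsum]
    simp only [mul_sub, sub_smul, Finset.sum_sub_distrib, ← Finset.smul_sum, mul_smul]
    rw [sub_sub_sub_comm, ← smul_sub (√t), ← smul_sub (t⁻¹), hone, smul_zero, smul_zero, zero_sub,
      neg_neg, smul_sub]
  have hintA : ∀ i, Integrable (fun t : ℝ => (√t * (t⁻¹ - (hA.eigenvalues i + t)⁻¹)) • x i)
      (volume.restrict (Set.Ioi 0)) := fun i => (integral_sqrt_mul_inv_sub_inv (hA0 i)).1.smul_const _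
  have hintT : ∀ j, Integrable (fun t : ℝ => (√t * (t⁻¹ - (hT.eigenvalues j + t)⁻¹)) • y j)
      (volume.restrict (Set.Ioi 0)) := fun i => (integral_sqrt_mul_inv_sub_inv (hT0 i)).1.smul_const _
  rw [hsum, setIntegral_congr_fun measurableSet_Ioi herr, integral_neg,
    integral_sub (integrable_finsetSum _ fun i _ => hintA i)
      (integrable_finsetSum _ fun i _ => hintT i),
    integral_finsetSum _ fun i _ => hintA i, integral_finsetSum _ fun i _ => hintT i]
  simp only [integral_smul_const, (integral_sqrt_mul_inv_sub_inv (hA0 _)).2,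
    (integral_sqrt_mul_inv_sub_inv (hT0 _)).2]
  rw [smul_neg, neg_neg, smul_sub, Finset.smul_sum, Finset.smul_sum]
  simp only [smul_smul, inv_mul_cancel_left₀ Real.pi_pos.ne']

theorem lanczos_fa_sqrt_bound
    {n k : ℕ} (hn : 0 < n) (hk : 0 < k)
    (A : Matrix (Fin n) (Fin n) ℂ) (hA : A.IsHermitian)
    (b : Fin n → ℂ) (hb : b ≠ 0)
    (Q : Matrix (Fin n) (Fin k) ℂ) (hQ : Qᴴ * Q = 1)
    (hQb : Q.mulVec (Pi.single (⟨0, hk⟩ : Fin k) 1) = (norm2 b)⁻¹ • b)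
    (T : Matrix (Fin k) (Fin k) ℝ) (hTsymm : T.IsSymm)
    (hTtri : ∀ i j : Fin k, (i : ℕ) + 1 < (j : ℕ) ∨ (j : ℕ) + 1 < (i : ℕ) → T i j = 0)
    (hToff : ∀ i j : Fin k, (i : ℕ) + 1 = (j : ℕ) → 0 < T i j)
    (βk : ℝ) (hβk : 0 < βk)
    (q : Fin n → ℂ) (hq : norm2 q = 1) (hQq : Qᴴ.mulVec q = 0)
    (hAQ : A * Q = Q * T.map Complex.ofReal + (βk : ℂ) •
      Matrix.vecMulVec q (Pi.single (⟨k - 1, Nat.sub_lt hk Nat.one_pos⟩ : Fin k) 1))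
    (hApd : A.PosDef) (hTH : (T.map Complex.ofReal).IsHermitian) :
    norm2 ((matFun hA fun x : ℝ => ((Real.sqrt x : ℝ) : ℂ)).mulVec b -
        (Q * matFun hTH (fun x : ℝ => ((Real.sqrt x : ℝ) : ℂ)) * Qᴴ).mulVec b) ≤
      (⨆ i, hA.eigenvalues i) ^ ((3 : ℝ) / 2) / (2 * Real.sqrt Real.pi) *
        (Real.Gamma ((k : ℝ) - 1 / 2) / Real.Gamma ((k : ℝ) + 1)) *
        norm2 (errK A Q (T.map Complex.ofReal) b 0) := by
  have : Nonempty (Fin n) := ⟨⟨0, hn⟩⟩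
  obtain ⟨m, rfl⟩ : ∃ m, k = m + 1 := ⟨k - 1, by lia⟩
  have hb0 : norm2 b ≠ 0 := by
    rw [norm2_eq_norm_toLp, norm_ne_zero_iff]
    simpa using hb
  have hbQ : b = (norm2 b : ℂ) • Q *ᵥ Pi.single 0 1 := by
    have h0 : (⟨0, hk⟩ : Fin (m + 1)) = 0 := rfl
    rw [← h0, hQb, Complex.coe_smul, smul_inv_smul₀ hb0]
  have hQb' : Qᴴ *ᵥ b = (norm2 b : ℂ) • Pi.single 0 1 := by
    nth_rewrite 1 [hbQ]
    rw [mulVec_smul, mulVec_mulVec, hQ, one_mulVec]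
  have hQQ : Q *ᵥ (Qᴴ *ᵥ b) = b := by
    rw [hQb', mulVec_smul, ← hbQ]
  have hAQ' : A * Q = Q * T.map Complex.ofReal +
      vecMulVec ((βk : ℂ) • q) (Pi.single (Fin.last m) 1) := by
    rw [hAQ, smul_vecMulVec]
    rfl
  have hTA : Qᴴ * A * Q = T.map Complex.ofReal := by
    rw [Matrix.mul_assoc, hAQ, Matrix.mul_add, ← Matrix.mul_assoc, hQ, Matrix.one_mul,
      Matrix.mul_smul, mul_vecMulVec, hQq, zero_vecMulVec, smul_zero, add_zero]
  have hTpd : (T.map Complex.ofReal).PosDef := by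
    rw [← hTA]
    refine hApd.conjTranspose_mul_mul_same fun v w hvw => ?_
    have h := congrArg (Qᴴ *ᵥ ·) hvw
    simpa [mulVec_mulVec, hQ] using h
  have hA0 : ∀ i, 0 < hA.eigenvalues i := hApd.eigenvalues_pos
  have hT0 : ∀ i, 0 < hTH.eigenvalues i := hTpd.eigenvalues_pos
  set L := ⨆ i, hA.eigenvalues i with hL
  have hAL : ∀ i, hA.eigenvalues i ≤ L := le_ciSup (Set.finite_range _).bddAbove
  have hLpos : 0 < L := (hA0 ⟨0, hn⟩).trans_le (hAL _)
  have hTL := eigenvalues_compression_le hA hQ hTH hTA hAL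
  have hT' : ∀ i j : Fin (m + 1), (j : ℕ) + 1 < (i : ℕ) → T.map Complex.ofReal i j = 0 := by
    intro i j hij
    simp [hTtri i j (Or.inr hij)]
  obtain ⟨hint, hval⟩ := integral_sqrt_mul_div_pow hLpos m
  set E := norm2 (errK A Q (T.map Complex.ofReal) b 0) with hE
  have hbound : ‖∫ t in Set.Ioi (0 : ℝ),
      √t • WithLp.toLp 2 (errK A Q (T.map Complex.ofReal) b (-t : ℝ))‖ ≤
      ∫ t in Set.Ioi (0 : ℝ), √t * (L / (L + t)) ^ (m + 2) * E := by
    refine norm_integral_le_of_norm_le (hint.mul_const E) ?_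
    refine (ae_restrict_iff' measurableSet_Ioi).2 (Filter.Eventually.of_forall fun t ht => ?_)
    rw [norm_smul, ← norm2_eq_norm_toLp, Real.norm_of_nonneg (Real.sqrt_nonneg t), mul_assoc]
    gcongr
    exact norm2_errK_le hA hTH hQQ hQb' hT' hAQ' hA0 hAL hT0 hTL hLpos ht
  rw [integral_mul_const, hval] at hbound
  rw [norm2_eq_norm_toLp, sqrt_error_eq_integral hA hTH hQQ hA0 hT0, norm_neg, norm_smul,
    Real.norm_of_nonneg (inv_nonneg.2 Real.pi_pos.le)]
  refine (mul_le_mul_of_nonneg_left hbound (inv_nonneg.2 Real.pi_pos.le)).trans_eq ?_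
  have hp : √Real.pi ^ 2 = Real.pi := Real.sq_sqrt Real.pi_pos.le
  have hs : √Real.pi ≠ 0 := (Real.sqrt_pos.2 Real.pi_pos).ne'
  nth_rewrite 1 [← hp]
  push_cast
  field_simp
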